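/- Let X be a real Banach space and suppose there exists c > 0 such that for every finite-dimensional subspace M of X, the quotient map φ : X → X/M admits a right inverse ψ : X/M → X that is Lipschitz with constant c and satisfies φ(ψ(u)) = u for all u ∈ X/M. Then X is isomorphic to a Hilbert space. -/

import Mathlib

open scoped NNReal

universe u

variable (X : Type u) [NormedAddCommGroup X] [NormedSpace ℝ X]

/-- `f` is a real inner product on `X`: symmetric, bilinear, positive definite. -/
def IsRealInner (f : X → X → ℝ) : Prop :=
  (∀ x y, f x y = f y x) ∧
  (∀ (a : ℝ) (x y : X), f (a • x) y = a * f x y) ∧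
  (∀ x y z : X, f (x + y) z = f x z + f y z) ∧
  (∀ x : X, x ≠ 0 → 0 < f x x)

/-- `X` is isomorphic to a Hilbert space: there is a real inner product on `X` whose
induced norm is equivalent to the given norm. -/
def IsomorphicToHilbert : Prop :=
  ∃ f : X → X → ℝ, IsRealInner X f ∧
    ∃ a b : ℝ, 0 < a ∧ 0 < b ∧ ∀ x : X, a * ‖x‖ ^ 2 ≤ f x x ∧ f x x ≤ b * ‖x‖ ^ 2

section Auxiliary

open Filter Topology Set

section MarkovKakutani

variable {V : Type*} [AddCommGroup V] [Module ℝ V] [TopologicalSpace V]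
  [IsTopologicalAddGroup V] [ContinuousSMul ℝ V] [T2Space V]

/-- A continuous linear self-map of a nonempty compact convex set has a fixed point. -/
theorem exists_fixedPoint_of_isCompact_convex {K : Set V} (hK : IsCompact K)
    (hc : Convex ℝ K) (hne : K.Nonempty) (T : V →ₗ[ℝ] V) (hT : Continuous T)
    (hTK : MapsTo T K K) : ∃ x ∈ K, T x = x := by
  obtain ⟨x₀, hx₀⟩ := hne
  have horb : ∀ n, (T ^ n) x₀ ∈ K := by
    intro n
    induction n with
    | zero => simpa using hx₀
    | succ n ih => rw [pow_succ', Module.End.mul_apply]; exact hTK ih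
  let a : ℕ → V := fun n ↦ ∑ i ∈ Finset.range (n + 1), ((n : ℝ) + 1)⁻¹ • (T ^ i) x₀
  have ha : ∀ n, a n ∈ K := fun n ↦ hc.sum_mem (fun _ _ ↦ by positivity)
    (by simp; field_simp) (fun i _ ↦ horb i)
  have hdiff : ∀ n, T (a n) - a n = ((n : ℝ) + 1)⁻¹ • ((T ^ (n + 1)) x₀ - x₀) := by
    intro n
    simp only [a, map_sum, map_smul, ← Finset.smul_sum, ← smul_sub]
    congr 1
    rw [← Finset.sum_sub_distrib]
    simp only [← Module.End.mul_apply, ← pow_succ']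
    rw [Finset.sum_range_sub (fun i ↦ (T ^ i) x₀)]
    simp
  have hlim : Tendsto (fun n ↦ T (a n) - a n) atTop (𝓝 0) := by
    have hb : Bornology.IsVonNBounded ℝ ((fun x ↦ x - x₀) '' K) :=
      (hK.image (by fun_prop)).isVonNBounded ℝ
    have := hb.smul_tendsto_zero (l := atTop) (ε := fun n : ℕ ↦ ((n : ℝ) + 1)⁻¹)
      (x := fun n ↦ (T ^ (n + 1)) x₀ - x₀)
      (Eventually.of_forall fun n ↦ mem_image_of_mem _ (horb _))
      (by simpa using tendsto_one_div_add_atTop_nhds_zero_nat (𝕜 := ℝ))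
    exact this.congr fun n ↦ (hdiff n).symm
  let U : Ultrafilter ℕ := Ultrafilter.of atTop
  obtain ⟨x, hx, hUx⟩ := hK.ultrafilter_le_nhds (U.map a)
    (le_principal_iff.2 (Eventually.of_forall ha : ∀ᶠ n in U, a n ∈ K))
  have hax : Tendsto a U (𝓝 x) := hUx
  refine ⟨x, hx, ?_⟩
  have h1 : Tendsto (fun n ↦ T (a n) - a n) U (𝓝 (T x - x)) :=
    ((hT.tendsto x).comp hax).sub hax
  exact sub_eq_zero.1 (tendsto_nhds_unique h1 (hlim.mono_left (Ultrafilter.of_le _)))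

/-- The Markov–Kakutani fixed point theorem for a commuting family of linear maps. -/
theorem exists_common_fixedPoint {ι : Type*} {K : Set V} (hK : IsCompact K)
    (hc : Convex ℝ K) (hne : K.Nonempty) (T : ι → V →ₗ[ℝ] V) (hT : ∀ i, Continuous (T i))
    (hcomm : ∀ i j x, T i (T j x) = T j (T i x))
    (hTK : ∀ i, MapsTo (T i) K K) : ∃ x ∈ K, ∀ i, T i x = x := by
  classical
  have hclosed : ∀ i, IsClosed {x | T i x = x} := fun i ↦ isClosed_eq (hT i) continuous_id
  have hfin : ∀ s : Finset ι, (K ∩ ⋂ i ∈ s, {x | T i x = x}).Nonempty := by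
    intro s
    induction s using Finset.induction_on with
    | empty => simpa using hne
    | insert j s _ ih =>
      have hcl : IsClosed (⋂ i ∈ s, {x | T i x = x}) :=
        isClosed_biInter fun i _ ↦ hclosed i
      have hcv : Convex ℝ (⋂ i ∈ s, {x | T i x = x}) := by
        refine convex_iInter₂ fun i _ x hx y hy a b _ _ _ ↦ ?_
        simp only [mem_ofPred_eq, map_add, map_smul] at *
        rw [hx, hy]
      obtain ⟨x, hx, hxj⟩ := exists_fixedPoint_of_isCompact_convex (hK.inter_right hcl)
        (hc.inter hcv) ih (T j) (hT j) (by
          rintro x ⟨hx, hx'⟩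
          refine ⟨hTK j hx, ?_⟩
          simp only [mem_iInter, mem_ofPred_eq] at hx' ⊢
          intro i hi
          rw [hcomm, hx' i hi])
      refine ⟨x, hx.1, ?_⟩
      simp only [Finset.mem_insert, iInter_iInter_eq_or_left]
      exact ⟨hxj, hx.2⟩
  obtain ⟨x, hx, hx'⟩ := hK.inter_iInter_nonempty _ hclosed hfin
  exact ⟨x, hx, by simpa using hx'⟩

end MarkovKakutani

section Projection

variable {E : Type*} [NormedAddCommGroup E] [NormedSpace ℝ E]

/-- The increment operator `p ↦ (x ↦ p (x + g) - p g)`. -/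
def increment {F : Type*} [AddCommGroup F] [Module ℝ F] (g : E) : (E → F) →ₗ[ℝ] (E → F) where
  toFun p x := p (x + g) - p g
  map_add' p q := by ext x; simp only [Pi.add_apply]; abel
  map_smul' a p := by ext x; simp [smul_sub]

omit [NormedSpace ℝ E] in
theorem increment_apply {F : Type*} [AddCommGroup F] [Module ℝ F] (g : E) (p : E → F) (x : E) :
    increment g p x = p (x + g) - p g := rfl

/-- A finite-dimensional subspace that is a Lipschitz retract is the range of a linear projection
with the same bound. -/
theorem exists_projection_of_lipschitz_retraction (M : Submodule ℝ E) [FiniteDimensional ℝ M]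
    {L : ℝ≥0} (r : E → M) (hr : LipschitzWith L r) (hrM : ∀ m : M, r m = m) :
    ∃ P : E →ₗ[ℝ] M, (∀ x, ‖P x‖ ≤ L * ‖x‖) ∧ ∀ m : M, P m = m := by
  let K : Set (E → M) := {p | (∀ x y, ‖p x - p y‖ ≤ L * ‖x - y‖) ∧ ∀ m : M, p m = m}
  have hT : ∀ g : E, Continuous (increment g : (E → M) →ₗ[ℝ] (E → M)) := fun g ↦
    continuous_pi fun x ↦ (continuous_apply (x + g)).sub (continuous_apply g)
  have hcomm : ∀ (g h : E) (p : E → M), increment g (increment h p) =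
      increment h (increment g p) := by
    intro g h p
    ext x
    simp [increment_apply, add_right_comm x g h, add_comm g h]
  have hKbdd : ∀ p ∈ K, ∀ x, ‖p x‖ ≤ L * ‖x‖ := by
    intro p hp x
    have h0 : p 0 = 0 := by simpa using hp.2 0
    simpa [h0] using hp.1 x 0
  have hKcl : IsClosed K := by
    have : K = (⋂ (x) (y), {p : E → M | ‖p x - p y‖ ≤ L * ‖x - y‖}) ∩
        ⋂ m : M, {p : E → M | p m = m} := by
      ext p; simp [K]
    rw [this]
    refine (isClosed_iInter fun x ↦ isClosed_iInter fun y ↦ ?_).inter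
      (isClosed_iInter fun m ↦ ?_)
    · exact isClosed_le (by fun_prop) continuous_const
    · exact isClosed_eq (continuous_apply _) continuous_const
  have hKc : IsCompact K := by
    have : ProperSpace M := FiniteDimensional.proper ℝ M
    refine (isCompact_univ_pi fun x : E ↦ isCompact_closedBall (0 : M) (L * ‖x‖)).of_isClosed_subset
      hKcl fun p hp x _ ↦ ?_
    simpa using hKbdd p hp x
  have hKconv : Convex ℝ K := by
    intro p hp q hq a b ha hb hab
    refine ⟨fun x y ↦ ?_, fun m ↦ ?_⟩
    · calc ‖(a • p + b • q) x - (a • p + b • q) y‖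
          = ‖a • (p x - p y) + b • (q x - q y)‖ := by
            congr 1; simp only [Pi.add_apply, Pi.smul_apply, smul_sub]; abel
        _ ≤ a * ‖p x - p y‖ + b * ‖q x - q y‖ := by
            refine (norm_add_le _ _).trans_eq ?_
            rw [norm_smul, norm_smul, Real.norm_of_nonneg ha, Real.norm_of_nonneg hb]
        _ ≤ a * (L * ‖x - y‖) + b * (L * ‖x - y‖) := by
            gcongr
            exacts [hp.1 x y, hq.1 x y]
        _ = L * ‖x - y‖ := by rw [← add_mul, hab, one_mul]
    · simp only [Pi.add_apply, Pi.smul_apply, hp.2, hq.2, ← add_smul, hab, one_smul]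
  have hlip : ∀ g : E, ∀ p ∈ K, ∀ x y, ‖increment g p x - increment g p y‖ ≤ L * ‖x - y‖ := by
    intro g p hp x y
    simpa [increment_apply] using hp.1 (x + g) (y + g)
  obtain ⟨p, hp, hpM⟩ := exists_common_fixedPoint hKc hKconv
    ⟨r, fun x y ↦ hr.norm_sub_le x y, hrM⟩ (fun m : M ↦ increment (F := M) (m : E))
    (fun m ↦ hT _) (fun m n q ↦ hcomm _ _ q) (by
      intro g q hq
      refine ⟨hlip g q hq, fun m ↦ ?_⟩
      rw [increment_apply, ← Submodule.coe_add, hq.2, hq.2]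
      simp)
  let K' : Set (E → M) := K ∩ ⋂ m : M, {q | increment (m : E) q = q}
  have hK'c : IsCompact K' := hKc.inter_right
    (isClosed_iInter fun m ↦ isClosed_eq (hT _) continuous_id)
  have hK'conv : Convex ℝ K' := by
    refine hKconv.inter (convex_iInter fun m q hq q' hq' a b _ _ _ ↦ ?_)
    simp only [mem_ofPred_eq, map_add, map_smul] at *
    rw [hq, hq']
  obtain ⟨q, hq, hqE⟩ := exists_common_fixedPoint hK'c hK'conv
    ⟨p, hp, by simpa using hpM⟩ (fun g : E ↦ increment (F := M) g) hT hcomm (by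
      rintro g q ⟨hq, hq'⟩
      simp only [mem_iInter, mem_ofPred_eq] at hq'
      refine ⟨⟨hlip g q hq, fun m ↦ ?_⟩, ?_⟩
      · have := congrFun (hq' m) g
        rw [increment_apply, hq.2] at this
        rw [increment_apply, add_comm, ← this]
        abel
      · simp only [mem_iInter, mem_ofPred_eq]
        intro m
        rw [hcomm, hq' m])
  have hadd : ∀ x y, q (x + y) = q x + q y := fun x y ↦ by
    have := congrFun (hqE y) x
    rw [increment_apply] at this
    rw [← this]; abel
  have hqL : LipschitzWith L q := LipschitzWith.of_dist_le_mul fun x y ↦ by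
    simpa [dist_eq_norm] using hq.1.1 x y
  let Q : E →+ M := AddMonoidHom.mk' q hadd
  exact ⟨(Q.toRealLinearMap hqL.continuous).toLinearMap, fun x ↦ hKbdd q hq.1 x, hq.1.2⟩

/-- A Lipschitz right inverse of the quotient map by a finite-dimensional subspace `M`
yields a bounded linear projection onto `M`. -/
theorem exists_projection_of_lipschitz_right_inverse (M : Submodule ℝ E) [FiniteDimensional ℝ M]
    {c : ℝ≥0} (ψ : E ⧸ M → E) (hψ : LipschitzWith c ψ)
    (hψM : ∀ u : E ⧸ M, Submodule.Quotient.mk (ψ u) = u) :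
    ∃ P : E →ₗ[ℝ] M, (∀ x, ‖P x‖ ≤ (1 + c) * ‖x‖) ∧ ∀ m : M, P m = m := by
  have hmem : ∀ x : E, x - ψ (Submodule.Quotient.mk x) + ψ 0 ∈ M := by
    intro x
    rw [← Submodule.Quotient.mk_eq_zero, Submodule.Quotient.mk_add, Submodule.Quotient.mk_sub,
      hψM, hψM]
    simp
  let r : E → M := fun x ↦ ⟨_, hmem x⟩
  have hr : LipschitzWith (1 + c) r := by
    refine LipschitzWith.of_dist_le_mul fun x y ↦ ?_
    rw [Subtype.dist_eq, dist_eq_norm, dist_eq_norm]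
    calc ‖x - ψ (Submodule.Quotient.mk x) + ψ 0 - (y - ψ (Submodule.Quotient.mk y) + ψ 0)‖
        = ‖(x - y) - (ψ (Submodule.Quotient.mk x) - ψ (Submodule.Quotient.mk y))‖ := by
          congr 1; abel
      _ ≤ ‖x - y‖ + c * ‖(Submodule.Quotient.mk x : E ⧸ M) - Submodule.Quotient.mk y‖ :=
          (norm_sub_le _ _).trans (by gcongr; exact hψ.norm_sub_le _ _)
      _ ≤ ‖x - y‖ + c * ‖x - y‖ := by
          gcongr
          rw [← Submodule.Quotient.mk_sub]
          exact Submodule.Quotient.norm_mk_le M _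
      _ = _ := by push_cast; ring
  have hrM : ∀ m : M, r m = m := by
    intro m
    ext
    have : (Submodule.Quotient.mk (m : E) : E ⧸ M) = 0 := by simp
    simp only [r, this]
    abel
  simpa using exists_projection_of_lipschitz_retraction M r hr hrM

end Projection

section Euclidean
variable {E : Type*} [NormedAddCommGroup E] [NormedSpace ℝ E]

/-- The subspace `F` embeds into a finite-dimensional Euclidean space with distortion `d`. -/
def EuclideanDistortionLE (F : Submodule ℝ E) (d : ℝ) : Prop :=
  ∃ (k : ℕ) (v : F →ₗ[ℝ] EuclideanSpace ℝ (Fin k)), ∀ x, ‖x‖ ≤ ‖v x‖ ∧ ‖v x‖ ≤ d * ‖x‖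

/-- A normed space whose finite-dimensional subspaces are uniformly Euclidean is Hilbertian. -/
theorem isomorphicToHilbert_of_finiteDimensional {d : ℝ}
    (hd : ∀ (F : Submodule ℝ E) [FiniteDimensional ℝ F], EuclideanDistortionLE F d) :
    IsomorphicToHilbert E := by
  classical
  have hspan : ∀ s : Finset E, EuclideanDistortionLE (Submodule.span ℝ (s : Set E)) d :=
    fun s ↦ hd _
  choose k v hv using hspan
  let B : Finset E → E → E → ℝ := fun s x y ↦
    if h : x ∈ Submodule.span ℝ (s : Set E) ∧ y ∈ Submodule.span ℝ (s : Set E) then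
      inner ℝ (v s ⟨x, h.1⟩) (v s ⟨y, h.2⟩) else 0
  have hB : ∀ (s : Finset E) (x y : Submodule.span ℝ (s : Set E)),
      B s x y = inner ℝ (v s x) (v s y) := fun s x y ↦ by
    simp [B]
  have hbd : ∀ s x y, B s x y ∈ Icc (-((d * ‖x‖) * (d * ‖y‖))) ((d * ‖x‖) * (d * ‖y‖)) := by
    intro s x y
    refine abs_le.1 ?_
    by_cases h : x ∈ Submodule.span ℝ (s : Set E) ∧ y ∈ Submodule.span ℝ (s : Set E)
    · have := hB s ⟨x, h.1⟩ ⟨y, h.2⟩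
      simp only at this
      rw [this]
      have h1 := (hv s ⟨x, h.1⟩).2
      have h2 := (hv s ⟨y, h.2⟩).2
      refine (abs_real_inner_le_norm _ _).trans ?_
      exact mul_le_mul h1 h2 (norm_nonneg _) ((norm_nonneg _).trans h1)
    · simp only [B, dif_neg h, abs_zero]
      by_cases hx : x = 0
      · simp [hx]
      have hx' : x ∈ Submodule.span ℝ (({x} : Finset E) : Set E) :=
        Submodule.subset_span (by simp)
      have h2 := hv {x} ⟨x, hx'⟩
      have h3 : ‖x‖ ≤ d * ‖x‖ := h2.1.trans h2.2
      have hd0 : 0 ≤ d := by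
        have := norm_pos_iff.2 hx
        by_contra! hcon
        nlinarith
      positivity
  let U : Ultrafilter (Finset E) := Ultrafilter.of atTop
  have hlim : ∀ x y, ∃ b, Tendsto (fun s ↦ B s x y) U (𝓝 b) := by
    intro x y
    obtain ⟨b, -, hb⟩ := isCompact_Icc.ultrafilter_le_nhds (U.map fun s ↦ B s x y)
      (le_principal_iff.2 (Eventually.of_forall fun s ↦ hbd s x y : ∀ᶠ s in U, B s x y ∈ Icc _ _))
    exact ⟨b, hb⟩
  choose f hf using hlim
  have hmem : ∀ x : E, ∀ᶠ s in U, x ∈ Submodule.span ℝ ((s : Finset E) : Set E) := by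
    intro x
    have : ∀ᶠ s : Finset E in atTop, x ∈ Submodule.span ℝ (s : Set E) := by
      filter_upwards [eventually_ge_atTop {x}] with s hs
      exact Submodule.subset_span (by simpa using hs)
    exact (Ultrafilter.of_le atTop) this
  have hlow : ∀ x, ‖x‖ ^ 2 ≤ f x x := by
    intro x
    refine ge_of_tendsto (hf x x) ?_
    filter_upwards [hmem x] with s hs
    have := hB s ⟨x, hs⟩ ⟨x, hs⟩
    simp only at this
    rw [this, real_inner_self_eq_norm_sq]
    have := (hv s ⟨x, hs⟩).1
    exact pow_le_pow_left₀ (norm_nonneg _) this 2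
  refine ⟨f, ⟨fun x y ↦ ?_, fun a x y ↦ ?_, fun x y z ↦ ?_, fun x hx ↦ ?_⟩,
    1, d ^ 2 + 1, one_pos, by positivity, fun x ↦ ⟨by simpa using hlow x, ?_⟩⟩
  · refine tendsto_nhds_unique_of_eventuallyEq (hf x y) (hf y x) ?_
    filter_upwards [hmem x, hmem y] with s hx hy
    rw [hB s ⟨x, hx⟩ ⟨y, hy⟩, hB s ⟨y, hy⟩ ⟨x, hx⟩, real_inner_comm]
  · refine tendsto_nhds_unique_of_eventuallyEq (hf (a • x) y) ((hf x y).const_mul a) ?_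
    filter_upwards [hmem x, hmem y] with s hx hy
    rw [hB s ⟨x, hx⟩ ⟨y, hy⟩, ← real_inner_smul_left, ← map_smul]
    exact hB s (a • ⟨x, hx⟩) ⟨y, hy⟩
  · refine tendsto_nhds_unique_of_eventuallyEq (hf (x + y) z) ((hf x z).add (hf y z)) ?_
    filter_upwards [hmem x, hmem y, hmem z] with s hx hy hz
    rw [hB s ⟨x, hx⟩ ⟨z, hz⟩, hB s ⟨y, hy⟩ ⟨z, hz⟩, ← inner_add_left, ← map_add]
    exact hB s (⟨x, hx⟩ + ⟨y, hy⟩) ⟨z, hz⟩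
  · exact (by have := norm_pos_iff.2 hx; positivity : 0 < ‖x‖ ^ 2).trans_le (hlow x)
  · refine le_of_tendsto (hf x x) (Eventually.of_forall fun s ↦ ?_)
    nlinarith [(hbd s x x).2, sq_nonneg ‖x‖]

end Euclidean

section DvoretzkyRogers

variable {E : Type*} [NormedAddCommGroup E] [NormedSpace ℝ E]

theorem exists_injective_linearMap_of_infiniteDimensional (hE : ¬ FiniteDimensional ℝ E) (n : ℕ) :
    ∃ e : EuclideanSpace ℝ (Fin n) →ₗ[ℝ] E, Function.Injective e := by
  have hr : (n : Cardinal) ≤ Module.rank ℝ E := by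
    refine (Cardinal.natCast_lt_aleph0.le).trans (not_lt.1 fun h ↦ hE ?_)
    exact Module.rank_lt_aleph0_iff.1 h
  obtain ⟨f, hf⟩ := Module.le_rank_iff_exists_linearMap.1 hr
  exact ⟨f ∘ₗ (WithLp.linearEquiv 2 ℝ (Fin n → ℝ)).toLinearMap,
    hf.comp (WithLp.linearEquiv 2 ℝ (Fin n → ℝ)).injective⟩

variable {H : Type*} [NormedAddCommGroup H] [InnerProductSpace ℝ H] [FiniteDimensional ℝ H]

theorem det_id_add_smul_starProjection (W : Submodule ℝ H) (t : ℝ) :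
    LinearMap.det (LinearMap.id + t • (W.starProjection : H →ₗ[ℝ] H)) =
      (1 + t) ^ Module.finrank ℝ W := by
  set f : H →ₗ[ℝ] H := LinearMap.id + t • (W.starProjection : H →ₗ[ℝ] H) with hf
  have hfx : ∀ x, f x = x + t • W.starProjection x := fun x ↦ rfl
  have hW : W ≤ W.comap f := fun x hx ↦ by
    rw [Submodule.mem_comap, hfx]
    exact W.add_mem hx (W.smul_mem _ (Submodule.starProjection_apply_mem W x))
  rw [LinearMap.det_eq_det_mul_det W f hW]
  have h1 : f.restrict hW = (1 + t) • LinearMap.id := by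
    ext x
    simp [hfx, Submodule.starProjection_eq_self_iff.2 x.2, add_smul]
  have h2 : W.mapQ W f hW = LinearMap.id := by
    ext x
    simp only [LinearMap.comp_apply, Submodule.mkQ_apply, Submodule.mapQ_apply, hfx,
      LinearMap.id_apply]
    rw [Submodule.Quotient.eq, add_sub_cancel_left]
    exact W.smul_mem _ (Submodule.starProjection_apply_mem W x)
  rw [h1, h2, LinearMap.det_smul, LinearMap.det_id, LinearMap.det_id]
  simp

theorem exists_pow_lt_pow (N : ℕ) (hN : 0 < N) :
    ∃ t : ℝ, 0 < t ∧ ∀ r : ℕ, N < 2 * r → (1 + t / 2) ^ N < (1 + t) ^ r := by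
  have hN' : (0 : ℝ) < N := by exact_mod_cast hN
  refine ⟨(N : ℝ)⁻¹, by positivity, fun r hr ↦ ?_⟩
  set t : ℝ := (N : ℝ)⁻¹ with ht
  have ht0 : 0 < t := by positivity
  have ht1 : t ≤ 1 := inv_le_one_of_one_le₀ (by exact_mod_cast hN)
  have hNt : N * t = 1 := mul_inv_cancel₀ hN'.ne'
  have key : (1 + t ^ 2 / 4) ^ N < 1 + t := by
    calc (1 + t ^ 2 / 4) ^ N ≤ (Real.exp (t ^ 2 / 4)) ^ N := by
          gcongr
          linarith [Real.add_one_le_exp (t ^ 2 / 4)]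
      _ = Real.exp (t / 4) := by
          rw [← Real.exp_nat_mul]
          congr 1
          calc (N : ℝ) * (t ^ 2 / 4) = (N * t) * t / 4 := by ring
            _ = _ := by rw [hNt, one_mul]
      _ < 1 + t := by
          have := Real.abs_exp_sub_one_sub_id_le (x := t / 4)
            (by rw [abs_of_pos (by positivity)]; linarith)
          have := (abs_le.1 this).2
          nlinarith
  refine lt_of_pow_lt_pow_left₀ 2 (by positivity) ?_
  calc ((1 + t / 2) ^ N) ^ 2 = (1 + t + t ^ 2 / 4) ^ N := by
        rw [← pow_mul, mul_comm, pow_mul]; congr 1; ring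
    _ ≤ ((1 + t) * (1 + t ^ 2 / 4)) ^ N := by
        gcongr
        nlinarith [pow_pos ht0 3]
    _ = (1 + t) ^ N * (1 + t ^ 2 / 4) ^ N := mul_pow _ _ _
    _ < (1 + t) ^ N * (1 + t) := by gcongr
    _ = (1 + t) ^ (N + 1) := (pow_succ _ _).symm
    _ ≤ (1 + t) ^ (r * 2) := by gcongr <;> [linarith; lia]
    _ = ((1 + t) ^ r) ^ 2 := pow_mul _ _ _

/-- A contraction of maximal determinant from a Euclidean space is not small on any subspace of
more than half the dimension. -/
theorem exists_contraction_large_on_subspaces (e : H →ₗ[ℝ] E) (he : Function.Injective e) :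
    ∃ u : H →ₗ[ℝ] E, (∀ a, ‖u a‖ ≤ ‖a‖) ∧
      ∀ W : Submodule ℝ H, Module.finrank ℝ H < 2 * Module.finrank ℝ W →
        ∃ a ∈ W, ‖a‖ = 1 ∧ 1 / 2 ≤ ‖u a‖ := by
  rcases (Module.finrank ℝ H).eq_zero_or_pos with hN | hN
  · refine ⟨0, fun a ↦ by simp, fun W hW ↦ ?_⟩
    have := W.finrank_le
    lia
  obtain ⟨C, -, hC⟩ := e.exists_antilipschitzWith (LinearMap.ker_eq_bot.2 he)
  let e' : H →L[ℝ] E := e.toContinuousLinearMap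
  have hC' : ∀ a, ‖a‖ ≤ C * ‖e' a‖ := e'.bound_of_antilipschitz hC
  let S : Set (H →L[ℝ] H) := {w | ∀ a, ‖e' (w a)‖ ≤ ‖a‖}
  have : ProperSpace (H →L[ℝ] H) := FiniteDimensional.proper ℝ _
  have hS : IsCompact S := by
    refine (isCompact_closedBall (0 : H →L[ℝ] H) C).of_isClosed_subset ?_ fun w hw ↦ ?_
    · have : S = ⋂ a, {w | ‖e' (w a)‖ ≤ ‖a‖} := by ext; simp [S]
      rw [this]
      exact isClosed_iInter fun a ↦ isClosed_le (by fun_prop) continuous_const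
    · rw [mem_closedBall_zero_iff]
      refine w.opNorm_le_bound C.2 fun a ↦ (hC' _).trans ?_
      exact mul_le_mul_of_nonneg_left (hw a) C.2
  set s : ℝ := (‖e'‖ + 1)⁻¹ with hs
  have hs0 : 0 < s := inv_pos.2 (by positivity)
  have hsS : s • ContinuousLinearMap.id ℝ H ∈ S := fun a ↦ by
    have h1 : ‖e' a‖ ≤ (‖e'‖ + 1) * ‖a‖ :=
      (e'.le_opNorm a).trans (by gcongr; linarith)
    simp only [smul_apply, ContinuousLinearMap.id_apply, map_smul, norm_smul,
      Real.norm_of_nonneg hs0.le]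
    rw [hs, inv_mul_le_iff₀ (by positivity)]
    exact h1
  obtain ⟨w, hwS, hw⟩ := hS.exists_isMaxOn ⟨_, hsS⟩
    (ContinuousLinearMap.continuous_det (𝕜 := ℝ) (E := H)).continuousOn
  have hdet : 0 < w.det := by
    refine lt_of_lt_of_le ?_ (hw hsS)
    have : (s • ContinuousLinearMap.id ℝ H).det = s ^ Module.finrank ℝ H := by
      change LinearMap.det (s • LinearMap.id) = _
      simp [LinearMap.det_smul]
    exact (pow_pos hs0 _).trans_eq this.symm
  refine ⟨e ∘ₗ w, hwS, fun W hW ↦ ?_⟩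
  by_contra! hsmall
  have hsmall' : ∀ a ∈ W, ‖e' (w a)‖ ≤ 1 / 2 * ‖a‖ := fun a ha ↦ by
    rcases eq_or_ne a 0 with rfl | ha0
    · simp
    · have ha1 : 0 < ‖a‖ := norm_pos_iff.2 ha0
      have h1 : ‖e' (w (‖a‖⁻¹ • a))‖ < 1 / 2 :=
        hsmall (‖a‖⁻¹ • a) (W.smul_mem _ ha) (by rw [norm_smul]; simp [ha1.ne'])
      rw [map_smul, map_smul, norm_smul, norm_inv, norm_norm, inv_mul_lt_iff₀ ha1] at h1
      linarith
  obtain ⟨t, ht, hpow⟩ := exists_pow_lt_pow _ hN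
  let g : H →L[ℝ] H := ContinuousLinearMap.id ℝ H + t • W.starProjection
  have hgS : (1 + t / 2)⁻¹ • (w ∘L g) ∈ S := fun a ↦ by
    have h1 : e' (w (g a)) = e' (w a) + t • e' (w (W.starProjection a)) := by simp [g]
    have h2 : ‖e' (w (g a))‖ ≤ (1 + t / 2) * ‖a‖ := by
      rw [h1]
      refine (norm_add_le _ _).trans ?_
      rw [norm_smul, Real.norm_of_nonneg ht.le]
      have h3 := hsmall' _ (W.starProjection_apply_mem a)
      have h4 := W.norm_starProjection_apply_le a
      nlinarith [hwS a]
    simp only [smul_apply, ContinuousLinearMap.comp_apply, map_smul, norm_smul,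
      norm_inv, Real.norm_of_nonneg (by positivity : 0 ≤ 1 + t / 2)]
    rwa [inv_mul_le_iff₀ (by positivity)]
  have hgdet : ((1 + t / 2)⁻¹ • (w ∘L g)).det =
      ((1 + t / 2) ^ Module.finrank ℝ H)⁻¹ * (w.det * (1 + t) ^ Module.finrank ℝ W) := by
    rw [← det_id_add_smul_starProjection W t]
    change LinearMap.det ((1 + t / 2)⁻¹ • ((w : H →ₗ[ℝ] H) ∘ₗ (g : H →ₗ[ℝ] H))) = _
    rw [LinearMap.det_smul, LinearMap.det_comp, inv_pow]
    rfl
  have hmax : ((1 + t / 2)⁻¹ • (w ∘L g)).det ≤ w.det := hw hgS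
  rw [hgdet, inv_mul_le_iff₀ (by positivity), mul_comm _ w.det] at hmax
  exact (hpow _ hW).not_ge (le_of_mul_le_mul_left hmax hdet)

/-- A form of the Dvoretzky–Rogers lemma. -/
theorem exists_dvoretzky_rogers (hE : ¬ FiniteDimensional ℝ E) (K : ℕ) :
    ∃ x : Fin K → E, (∀ i, 1 / 2 ≤ ‖x i‖) ∧
      ∀ a : Fin K → ℝ, ‖∑ i, a i • x i‖ ^ 2 ≤ ∑ i, a i ^ 2 := by
  obtain ⟨e, he⟩ := exists_injective_linearMap_of_infiniteDimensional hE (2 * K)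
  obtain ⟨u, hu, hlarge⟩ := exists_contraction_large_on_subspaces e he
  have hv : ∀ j ≤ K, ∃ v : Fin j → EuclideanSpace ℝ (Fin (2 * K)), Orthonormal ℝ v ∧
      ∀ i, 1 / 2 ≤ ‖u (v i)‖ := by
    intro j
    induction j with
    | zero => exact fun _ ↦ ⟨Fin.elim0, ⟨fun i ↦ i.elim0, fun i ↦ i.elim0⟩, fun i ↦ i.elim0⟩
    | succ j ih =>
      intro hj
      obtain ⟨v, hv, hvu⟩ := ih (by lia)
      have hfin : Module.finrank ℝ (Submodule.span ℝ (range v)) ≤ j := by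
        exact (finrank_range_le_card v).trans_eq (Fintype.card_fin j)
      have hsum := (Submodule.span ℝ (range v)).finrank_add_finrank_orthogonal
      rw [finrank_euclideanSpace_fin] at hsum
      obtain ⟨a, haW, ha, hau⟩ := hlarge (Submodule.span ℝ (range v))ᗮ (by
        rw [finrank_euclideanSpace_fin]; omega)
      have hav : ∀ i, inner ℝ (v i) a = 0 := fun i ↦
        (Submodule.mem_orthogonal _ _).1 haW _ (Submodule.subset_span (mem_range_self i))
      refine ⟨Fin.cons a v, ?_, fun i ↦ ?_⟩
      · rw [orthonormal_iff_ite] at hv ⊢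
        intro i i'
        induction i using Fin.cases with
        | zero =>
          induction i' using Fin.cases with
          | zero => simp [ha]
          | succ i' => simpa [(Fin.succ_ne_zero _).symm, real_inner_comm] using hav i'
        | succ i =>
          induction i' using Fin.cases with
          | zero => simp [hav]
          | succ i' => simp [hv]
      · induction i using Fin.cases with
        | zero => simpa using hau
        | succ i => simpa using hvu i
  obtain ⟨v, hv, hvu⟩ := hv K le_rfl
  refine ⟨fun i ↦ u (v i), hvu, fun a ↦ ?_⟩
  have h1 : ∑ i, a i • u (v i) = u (∑ i, a i • v i) := by simp
  have h2 : ‖∑ i, a i • v i‖ ^ 2 = ∑ i, a i ^ 2 := by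
    rw [← real_inner_self_eq_norm_sq, hv.inner_sum]
    simp [sq]
  rw [h1, ← h2]
  exact pow_le_pow_left₀ (norm_nonneg _) (hu _) 2

end DvoretzkyRogers

section EfronStein

open MeasureTheory

variable {ι Ω : Type*}

/-- Exchange the two copies of the coordinates in `s`. -/
def swapOn [DecidableEq ι] (s : Finset ι) (ω : ι → Ω × Ω) : ι → Ω × Ω :=
  fun i ↦ if i ∈ s then (ω i).swap else ω i

theorem swapOn_swapOn [DecidableEq ι] (s t : Finset ι) (ω : ι → Ω × Ω) :
    swapOn s (swapOn t ω) = swapOn (symmDiff s t) ω := by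
  ext i : 1
  by_cases hs : i ∈ s <;> by_cases ht : i ∈ t <;> simp [swapOn, hs, ht, Finset.mem_symmDiff]

theorem integral_comp_of_measurePreserving {α β : Type*} [MeasurableSpace α] [MeasurableSpace β]
    {P : Measure α} {Q : Measure β} {φ : α → β} (hφ : MeasurePreserving φ P Q) {g : β → ℝ}
    (hg : Measurable g) : ∫ a, g (φ a) ∂P = ∫ b, g b ∂Q := by
  rw [← hφ.map_eq, integral_map hφ.measurable.aemeasurable hg.aestronglyMeasurable]

variable [MeasurableSpace Ω] [Fintype ι] (μ : Measure Ω) [IsProbabilityMeasure μ]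

theorem measurePreserving_swapOn [DecidableEq ι] (s : Finset ι) :
    MeasurePreserving (swapOn s) (Measure.pi fun _ : ι ↦ μ.prod μ)
      (Measure.pi fun _ : ι ↦ μ.prod μ) := by
  refine measurePreserving_pi (fun _ : ι ↦ μ.prod μ) (fun _ : ι ↦ μ.prod μ)
    (f := fun i p ↦ if i ∈ s then p.swap else p) fun i ↦ ?_
  by_cases hi : i ∈ s
  · simpa [hi] using Measure.measurePreserving_swap (μ := μ) (ν := μ)
  · simp only [hi, if_false]
    exact MeasurePreserving.id (μ.prod μ)

/-- The Efron–Stein inequality, for a bounded function whose one-sided variations are square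
summable uniformly. -/
theorem integral_sub_integral_sq_le [DecidableEq ι] {f : (ι → Ω) → ℝ} (hf : Measurable f) {B W : ℝ}
    (hB : ∀ x, |f x| ≤ B)
    (hW : ∀ x y : ι → Ω, ∑ i, max 0 (f x - f (Function.update x i (y i))) ^ 2 ≤ W) :
    ∫ x, (f x - ∫ x, f x ∂Measure.pi fun _ : ι ↦ μ) ^ 2 ∂(Measure.pi fun _ : ι ↦ μ) ≤ W := by
  set P := Measure.pi fun _ : ι ↦ μ.prod μ with hP
  set Q := Measure.pi fun _ : ι ↦ μ with hQ
  let F : Finset ι → (ι → Ω × Ω) → ℝ := fun s ω ↦ f fun i ↦ (swapOn s ω i).1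
  have hFm : ∀ s, Measurable (F s) := fun s ↦ hf.comp <| measurable_pi_lambda _ fun i ↦
    measurable_fst.comp ((measurable_pi_apply i).comp (measurePreserving_swapOn μ s).measurable)
  have hFswap : ∀ s t ω, F s (swapOn t ω) = F (symmDiff s t) ω := fun s t ω ↦ by
    simp only [F, swapOn_swapOn]
  have hFb : ∀ s ω, ‖F s ω‖ ≤ B := fun s ω ↦ hB _
  have hint : ∀ {g : (ι → Ω × Ω) → ℝ} (C : ℝ), Measurable g → (∀ ω, ‖g ω‖ ≤ C) →
      Integrable g P := fun C hg hC ↦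
    Integrable.of_bound hg.aestronglyMeasurable C (Eventually.of_forall hC)
  have hFF : ∀ s t, Integrable (fun ω ↦ F s ω * F t ω) P := fun s t ↦
    hint (B * B) ((hFm s).mul (hFm t)) fun ω ↦ by
      rw [norm_mul]
      exact mul_le_mul (hFb _ _) (hFb _ _) (norm_nonneg _) ((norm_nonneg _).trans (hFb s ω))
  let G : Finset ι → ℝ := fun s ↦ ∫ ω, F ∅ ω * F s ω ∂P
  have hG : ∀ s t, ∫ ω, F s ω * F t ω ∂P = G (symmDiff t s) := fun s t ↦ by
    have h1 := integral_comp_of_measurePreserving (measurePreserving_swapOn μ s)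
      ((hFm s).mul (hFm t))
    simp only [Pi.mul_apply, hFswap, symmDiff_self] at h1
    exact h1.symm
  have hquad : ∀ {k : ℕ} (ε : Fin k → ℝ) (S : Fin k → Finset ι),
      ∫ ω, (∑ a, ε a * F (S a) ω) ^ 2 ∂P = ∑ a, ∑ b, ε a * ε b * G (symmDiff (S b) (S a)) := by
    intro k ε S
    have h1 : ∀ ω, (∑ a, ε a * F (S a) ω) ^ 2 =
        ∑ a, ∑ b, ε a * ε b * (F (S a) ω * F (S b) ω) := fun ω ↦ by
      rw [sq, Finset.sum_mul_sum]
      exact Finset.sum_congr rfl fun a _ ↦ Finset.sum_congr rfl fun b _ ↦ by ring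
    simp_rw [h1]
    rw [integral_finsetSum _ fun a _ ↦ integrable_finsetSum _ fun b _ ↦ (hFF _ _).const_mul _]
    refine Finset.sum_congr rfl fun a _ ↦ ?_
    rw [integral_finsetSum _ fun b _ ↦ (hFF _ _).const_mul _]
    refine Finset.sum_congr rfl fun b _ ↦ ?_
    rw [integral_const_mul, hG]
  have hstep : ∀ (s : Finset ι) (i : ι), i ∉ s → G s - G (insert i s) ≤ G ∅ - G {i} := by
    intro s i hi
    have h0 := hquad ![1, -1, -1, 1] ![∅, {i}, s, insert i s]
    have h1 : symmDiff {i} s = insert i s := by ext j; grind [Finset.mem_symmDiff]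
    have h2 : symmDiff (insert i s) s = {i} := by ext j; grind [Finset.mem_symmDiff]
    have h3 : symmDiff (insert i s) {i} = s := by ext j; grind [Finset.mem_symmDiff]
    have h4 : ∀ t : Finset ι, symmDiff ∅ t = t := fun t ↦ bot_symmDiff t
    have h5 : ∀ t : Finset ι, symmDiff t ∅ = t := fun t ↦ symmDiff_bot t
    have h1' := symmDiff_comm s {i} ▸ h1
    have h2' := symmDiff_comm (insert i s) s ▸ h2
    have h3' := symmDiff_comm (insert i s) {i} ▸ h3
    have h7 : 0 ≤ ∫ ω, (∑ a : Fin 4, ![(1 : ℝ), -1, -1, 1] a *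
        F (![∅, {i}, s, insert i s] a) ω) ^ 2 ∂P := integral_nonneg fun ω ↦ sq_nonneg _
    rw [h0] at h7
    simp [Fin.sum_univ_four, h1, h2, h3, h1', h2', h3', h4, h5, -Finset.mem_insert] at h7
    linarith
  have hsum : ∀ s : Finset ι, G ∅ - G s ≤ ∑ i ∈ s, (G ∅ - G {i}) := by
    intro s
    induction s using Finset.induction_on with
    | empty => simp
    | insert i s hi ih =>
      rw [Finset.sum_insert hi]
      linarith [hstep s i hi]
  have hmax : ∀ i, Integrable (fun ω ↦ max 0 (F ∅ ω - F {i} ω) ^ 2) P := fun i ↦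
    hint ((B + B) ^ 2) (by have := hFm; fun_prop) fun ω ↦ by
      have h1 := abs_le.1 (hFb ∅ ω)
      have h2 := abs_le.1 (hFb {i} ω)
      rw [norm_pow]
      refine pow_le_pow_left₀ (norm_nonneg _) ?_ 2
      rw [Real.norm_of_nonneg (le_max_left _ _)]
      exact max_le (by linarith) (by linarith)
  have hGi : ∀ i, G ∅ - G {i} = ∫ ω, max 0 (F ∅ ω - F {i} ω) ^ 2 ∂P := by
    intro i
    have h0 := hquad ![1, -1] ![∅, {i}]
    have h4 : ∀ t : Finset ι, symmDiff ∅ t = t := fun t ↦ bot_symmDiff t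
    have h5 : ∀ t : Finset ι, symmDiff t ∅ = t := fun t ↦ symmDiff_bot t
    have h6 : ∀ t : Finset ι, symmDiff t t = ∅ := fun t ↦ symmDiff_self t
    simp only [Fin.sum_univ_two, Matrix.cons_val_zero, Matrix.cons_val_one, h4, h5, h6] at h0
    have h1 : ∀ ω, (1 * F ∅ ω + -1 * F {i} ω) ^ 2 =
        max 0 (F ∅ ω - F {i} ω) ^ 2 + max 0 (F ∅ (swapOn {i} ω) - F {i} (swapOn {i} ω)) ^ 2 := by
      intro ω
      rw [hFswap, hFswap, h4, h6]
      rcases le_total (F ∅ ω) (F {i} ω) with h | h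
      · rw [max_eq_left (by linarith), max_eq_right (by linarith)]; ring
      · rw [max_eq_right (by linarith), max_eq_left (by linarith)]; ring
    have hm : Measurable fun ω ↦ max 0 (F ∅ ω - F {i} ω) ^ 2 := by have := hFm; fun_prop
    have h2 := integral_comp_of_measurePreserving (measurePreserving_swapOn μ {i}) hm
    have h3 := integral_add (hmax i)
      ((measurePreserving_swapOn μ {i}).integrable_comp_of_integrable (hmax i))
    simp only [Function.comp_apply] at h3
    simp_rw [h1] at h0
    linarith
  have hpair : MeasurePreserving (fun ω : ι → Ω × Ω ↦ (fun i ↦ (ω i).1, fun i ↦ (ω i).2)) P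
      (Q.prod Q) := measurePreserving_arrowProdEquivProdArrow Ω Ω ι (fun _ ↦ μ) (fun _ ↦ μ)
  have hF0 : ∀ ω, F ∅ ω = f fun i ↦ (ω i).1 := fun ω ↦ by simp [F, swapOn]
  have hFu : ∀ ω, F Finset.univ ω = f fun i ↦ (ω i).2 := fun ω ↦ by simp [F, swapOn]
  have hGe : G ∅ = ∫ x, f x ^ 2 ∂Q := by
    have := integral_comp_of_measurePreserving (measurePreserving_fst.comp hpair) (hf.pow_const 2)
    rw [← this]
    simp [G, hF0, sq]
  have hGu : G Finset.univ = (∫ x, f x ∂Q) ^ 2 := by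
    have := integral_comp_of_measurePreserving hpair
      ((hf.comp measurable_fst).mul (hf.comp measurable_snd))
    simp only [Pi.mul_apply, Function.comp_apply] at this
    rw [sq, ← integral_prod_mul, ← this]
    simp [G, hF0, hFu]
  have hfi : Integrable f Q := Integrable.of_bound hf.aestronglyMeasurable B (Eventually.of_forall hB)
  have hfi2 : Integrable (fun x ↦ f x ^ 2) Q :=
    Integrable.of_bound (hf.pow_const 2).aestronglyMeasurable (B ^ 2) (Eventually.of_forall fun x ↦ by
      rw [norm_pow]; exact pow_le_pow_left₀ (norm_nonneg _) (hB x) 2)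
  have hvar : ∫ x, (f x - ∫ x, f x ∂Q) ^ 2 ∂Q = G ∅ - G Finset.univ := by
    set M := ∫ x, f x ∂Q with hM
    have h1 : ∀ x, (f x - M) ^ 2 = f x ^ 2 - 2 * M * f x + M ^ 2 := fun x ↦ by ring
    simp_rw [h1]
    have h2 : Integrable (fun x ↦ 2 * M * f x) Q := hfi.const_mul _
    have h3 : Integrable (fun x ↦ f x ^ 2 - 2 * M * f x) Q := hfi2.sub h2
    rw [integral_add h3 (integrable_const _), integral_sub hfi2 h2, integral_const_mul,
      integral_const, hGe, hGu, ← hM]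
    simp
    ring
  rw [hvar]
  refine (hsum _).trans ?_
  simp_rw [hGi]
  rw [← integral_finsetSum _ fun i _ ↦ hmax i]
  refine (integral_mono (integrable_finsetSum _ fun i _ ↦ hmax i) (integrable_const W)
    fun ω ↦ ?_).trans_eq (by simp)
  refine (Finset.sum_le_sum fun i _ ↦ le_of_eq ?_).trans (hW (fun i ↦ (ω i).1) fun i ↦ (ω i).2)
  have : F {i} ω = f (Function.update (fun i ↦ (ω i).1) i (ω i).2) := by
    simp only [F]
    congr 1
    ext j : 1
    by_cases hj : j = i
    · subst hj; simp [swapOn]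
    · simp [swapOn, hj]
  rw [hF0, this]

end EfronStein

section RandomSums

open MeasureTheory

variable {E : Type*} [NormedAddCommGroup E] [NormedSpace ℝ E]

/-- A sum of vectors with random signs has on average at least the norm of each term. -/
theorem norm_le_sum_norm_signs {ι : Type*} [Fintype ι] [DecidableEq ι] (v : ι → E) (j : ι) :
    2 ^ Fintype.card ι * ‖v j‖ ≤ ∑ s : Finset ι, ‖∑ i, if i ∈ s then -v i else v i‖ := by
  set S : Finset ι → E := fun s ↦ ∑ i, if i ∈ s then -v i else v i with hS
  have hpair : ∀ s, 2 * ‖v j‖ ≤ ‖S s‖ + ‖S (symmDiff s {j}ᶜ)‖ := by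
    intro s
    have h1 : S s + S (symmDiff s {j}ᶜ) = if j ∈ s then -((2 : ℝ) • v j) else (2 : ℝ) • v j := by
      rw [hS, ← Finset.sum_add_distrib]
      rw [Finset.sum_eq_single j]
      · by_cases h : j ∈ s <;> simp [h, Finset.mem_symmDiff, two_smul]
      · intro i _ hij
        by_cases h : i ∈ s <;> simp [h, Finset.mem_symmDiff, hij]
      · simp
    refine le_trans (le_of_eq ?_) (norm_add_le _ _)
    rw [h1]
    split_ifs <;> simp [norm_smul]
  have hinv : ∑ s, ‖S (symmDiff s {j}ᶜ)‖ = ∑ s, ‖S s‖ :=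
    Equiv.sum_comp (Function.Involutive.toPerm _ (symmDiff_left_involutive ({j}ᶜ : Finset ι)))
      fun s ↦ ‖S s‖
  have := Finset.sum_le_sum fun s (_ : s ∈ Finset.univ) ↦ hpair s
  rw [Finset.sum_add_distrib, hinv, Finset.sum_const, Finset.card_univ, Fintype.card_finset,
    nsmul_eq_mul] at this
  push_cast at this
  linarith

theorem norm_sum_smul_le {ι Ω : Type*} [Fintype ι] {g : Ω → ℝ} (hg1 : ∀ ω, |g ω| ≤ 1)
    (x : ι → E) (ω : ι → Ω) : ‖∑ i, g (ω i) • x i‖ ≤ ∑ i, ‖x i‖ := by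
  refine (norm_sum_le _ _).trans (Finset.sum_le_sum fun i _ ↦ ?_)
  rw [norm_smul]
  exact mul_le_of_le_one_left (norm_nonneg _) (hg1 _)

variable {Ω : Type*} [MeasurableSpace Ω] (μ : Measure Ω) [IsProbabilityMeasure μ]

theorem measurable_norm_sum_smul {ι : Type*} [Fintype ι] {g : Ω → ℝ} (hg : Measurable g)
    (x : ι → E) : Measurable fun ω : ι → Ω ↦ ‖∑ i, g (ω i) • x i‖ := by
  have h1 : Continuous fun a : ι → ℝ ↦ ‖∑ i, a i • x i‖ := by fun_prop
  exact h1.measurable.comp (measurable_pi_lambda _ fun i ↦ hg.comp (measurable_pi_apply i))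

/-- The variance of the norm of a sum of independent bounded multiples of the vectors `x i`. -/
theorem variance_norm_sum_le {ι : Type*} [Fintype ι] {g : Ω → ℝ} (hg : Measurable g)
    (hg1 : ∀ ω, |g ω| ≤ 1) {x : ι → E} (hx : ∀ a : ι → ℝ, ‖∑ i, a i • x i‖ ^ 2 ≤ ∑ i, a i ^ 2) :
    ∫ ω, (‖∑ i, g (ω i) • x i‖ - ∫ ω, ‖∑ i, g (ω i) • x i‖ ∂Measure.pi fun _ : ι ↦ μ) ^ 2
      ∂(Measure.pi fun _ : ι ↦ μ) ≤ 4 := by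
  classical
  refine integral_sub_integral_sq_le μ (measurable_norm_sum_smul hg x) (B := ∑ i, ‖x i‖)
    (fun ω ↦ ?_) fun X Y ↦ ?_
  · rw [abs_norm]
    exact norm_sum_smul_le hg1 x ω
  obtain ⟨φ, hφ, hφX⟩ := exists_dual_vector'' ℝ (∑ i, g (X i) • x i)
  have hφle : ∀ v, φ v ≤ ‖v‖ := fun v ↦ (le_abs_self _).trans
    ((φ.le_opNorm v).trans (mul_le_of_le_one_left (norm_nonneg _) hφ))
  have hsq : ∑ i, φ (x i) ^ 2 ≤ 1 := by
    have h1 : ∑ i, φ (x i) ^ 2 ≤ ‖∑ i, φ (x i) • x i‖ := by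
      refine le_trans (le_of_eq ?_) (hφle _)
      simp [sq]
    have h2 := hx fun i ↦ φ (x i)
    have h3 : 0 ≤ ∑ i, φ (x i) ^ 2 := Finset.sum_nonneg fun i _ ↦ sq_nonneg _
    nlinarith
  calc _ ≤ ∑ i, 4 * φ (x i) ^ 2 := Finset.sum_le_sum fun i _ ↦ ?_
    _ ≤ 4 := by rw [← Finset.mul_sum]; linarith
  have h1 : ∑ j, g (Function.update X i (Y i) j) • x j =
      ∑ j, g (X j) • x j - (g (X i) - g (Y i)) • x i := by
    rw [eq_sub_iff_add_eq, ← Finset.add_sum_erase _ _ (Finset.mem_univ i),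
      ← Finset.add_sum_erase Finset.univ (fun j ↦ g (X j) • x j) (Finset.mem_univ i)]
    have : ∑ j ∈ Finset.univ.erase i, g (Function.update X i (Y i) j) • x j =
        ∑ j ∈ Finset.univ.erase i, g (X j) • x j :=
      Finset.sum_congr rfl fun j hj ↦ by
        rw [Function.update_of_ne (Finset.ne_of_mem_erase hj)]
    rw [this, Function.update_self, sub_smul]
    abel
  have h2 := hφle (∑ j, g (Function.update X i (Y i) j) • x j)
  have h3 : φ (∑ j, g (X j) • x j) = ‖∑ j, g (X j) • x j‖ := hφX
  rw [h1, map_sub, map_smul, h3, smul_eq_mul, ← h1] at h2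
  have h4 : (g (X i) - g (Y i)) * φ (x i) ≤ 2 * |φ (x i)| := by
    refine (le_abs_self _).trans ?_
    rw [abs_mul]
    gcongr
    have := abs_le.1 (hg1 (X i))
    have := abs_le.1 (hg1 (Y i))
    exact abs_le.2 ⟨by linarith, by linarith⟩
  calc _ ≤ (2 * |φ (x i)|) ^ 2 := by
        refine pow_le_pow_left₀ (le_max_left _ _) (max_le (by positivity) (by linarith)) 2
    _ = _ := by rw [mul_pow, sq_abs]; norm_num

theorem measurePreserving_curry (ι κ : Type*) [Fintype ι] [Fintype κ] :
    MeasurePreserving (fun (ω : ι × κ → Ω) i k ↦ ω (i, k)) (Measure.pi fun _ : ι × κ ↦ μ)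
      (Measure.pi fun _ : ι ↦ Measure.pi fun _ : κ ↦ μ) := by
  have := Measure.infinitePi_map_curry fun (_ : ι) (_ : κ) ↦ μ
  simp only [Measure.infinitePi_eq_pi] at this
  exact ⟨(MeasurableEquiv.curry ι κ Ω).measurable, this⟩

theorem measureReal_exists_forall_mem {ι κ : Type*} [Fintype ι] [Fintype κ] {s : Set Ω}
    (hs : MeasurableSet s) :
    (Measure.pi fun _ : ι × κ ↦ μ).real {ω | ∃ i, ∀ k, ω (i, k) ∈ s} =
      1 - (1 - μ.real s ^ Fintype.card κ) ^ Fintype.card ι := by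
  set t : Set (κ → Ω) := Set.univ.pi fun _ ↦ s with ht
  have htm : MeasurableSet t := MeasurableSet.univ_pi fun _ ↦ hs
  have h1 : {ω : ι × κ → Ω | ∃ i, ∀ k, ω (i, k) ∈ s} =
      (fun (ω : ι × κ → Ω) i k ↦ ω (i, k)) ⁻¹' (Set.univ.pi fun _ : ι ↦ tᶜ)ᶜ := by
    ext ω
    simp [ht, Set.mem_pi]
  have hm : MeasurableSet (Set.univ.pi fun _ : ι ↦ tᶜ) := MeasurableSet.univ_pi fun _ ↦ htm.compl
  rw [h1, (measurePreserving_curry μ ι κ).measureReal_preimage hm.compl.nullMeasurableSet,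
    probReal_compl_eq_one_sub hm]
  congr 1
  rw [Measure.real, Measure.pi_pi]
  simp only [Finset.prod_const, Finset.card_univ, ENNReal.toReal_pow]
  rw [← Measure.real, probReal_compl_eq_one_sub htm, Measure.real, ht, Measure.pi_pi]
  simp [Measure.real]

/-- A sum of independent symmetric multiples of vectors `y i`, with `m` multiples of each,
has large mean. -/
theorem le_integral_norm_sum {N m : ℕ} {g : Ω → ℝ} (hg : Measurable g)
    (hg1 : ∀ ω, |g ω| ≤ 1) {τ : Ω → Ω} (hτ : MeasurePreserving τ μ μ) (hgτ : ∀ ω, g (τ ω) = -g ω)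
    {y : Fin N → E} (hy : ∀ i, 1 / 2 ≤ ‖y i‖)
    (hN : (1 - μ.real {ω | 1 / 2 ≤ g ω} ^ m) ^ N ≤ 1 / 2) :
    √m / 8 ≤ ∫ ω, ‖∑ p, g (ω p) • (√m)⁻¹ • y p.1‖ ∂(Measure.pi fun _ : Fin N × Fin m ↦ μ) := by
  set Q := Measure.pi fun _ : Fin N × Fin m ↦ μ with hQ
  set f : (Fin N × Fin m → Ω) → ℝ := fun ω ↦ ‖∑ p, g (ω p) • (√m)⁻¹ • y p.1‖ with hf
  have hfm : Measurable f := measurable_norm_sum_smul hg fun p : Fin N × Fin m ↦ (√m)⁻¹ • y p.1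
  have hfi : Integrable f Q := Integrable.of_bound hfm.aestronglyMeasurable _
    (Eventually.of_forall fun ω ↦ by
      rw [norm_norm]; exact norm_sum_smul_le hg1 (fun p : Fin N × Fin m ↦ (√m)⁻¹ • y p.1) ω)
  let flip : Finset (Fin N) → (Fin N × Fin m → Ω) → Fin N × Fin m → Ω :=
    fun s ω p ↦ if p.1 ∈ s then τ (ω p) else ω p
  have hflip : ∀ s, MeasurePreserving (flip s) Q Q := fun s ↦ by
    refine measurePreserving_pi (fun _ : Fin N × Fin m ↦ μ) (fun _ : Fin N × Fin m ↦ μ)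
      (f := fun p ω ↦ if p.1 ∈ s then τ ω else ω) fun p ↦ ?_
    by_cases hp : p.1 ∈ s
    · simpa only [hp, if_true] using hτ
    · simp only [hp, if_false]
      exact MeasurePreserving.id μ
  let η : (Fin N × Fin m → Ω) → Fin N → E := fun ω i ↦ ∑ k, g (ω (i, k)) • (√m)⁻¹ • y i
  have hfflip : ∀ s ω, f (flip s ω) = ‖∑ i, if i ∈ s then -η ω i else η ω i‖ := fun s ω ↦ by
    simp only [hf, Fintype.sum_prod_type]
    congr 1
    refine Finset.sum_congr rfl fun i _ ↦ ?_
    by_cases hi : i ∈ s <;> simp [η, flip, hi, hgτ]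
  set A : Set (Fin N × Fin m → Ω) := {ω | ∃ i, ∀ k, ω (i, k) ∈ {ω | 1 / 2 ≤ g ω}} with hA
  have hgs : MeasurableSet {ω | 1 / 2 ≤ g ω} := measurableSet_le measurable_const hg
  have hAm : MeasurableSet A := by
    have : A = ⋃ i, ⋂ k, (fun ω : Fin N × Fin m → Ω ↦ ω (i, k)) ⁻¹' {ω | 1 / 2 ≤ g ω} := by
      ext; simp [hA]
    rw [this]
    exact MeasurableSet.iUnion fun i ↦ MeasurableSet.iInter fun k ↦ measurable_pi_apply _ hgs
  have hQA : 1 / 2 ≤ Q.real A := by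
    rw [hQ, hA, measureReal_exists_forall_mem μ hgs]
    simp only [Fintype.card_fin]
    linarith
  have hlow : ∀ ω, A.indicator (fun _ ↦ 2 ^ N * (√m / 4)) ω ≤ ∑ s, f (flip s ω) := by
    intro ω
    have h0 : ∀ ω, 0 ≤ ∑ s, f (flip s ω) := fun ω ↦ Finset.sum_nonneg fun s _ ↦ norm_nonneg _
    refine Set.indicator_le' (g := fun ω ↦ ∑ s, f (flip s ω)) (fun ω hω ↦ ?_) (fun ω _ ↦ h0 ω) ω
    obtain ⟨j, hj⟩ := hω
    simp_rw [hfflip]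
    have := norm_le_sum_norm_signs (η ω) j
    rw [Fintype.card_fin] at this
    refine le_trans ?_ this
    gcongr
    have h1 : η ω j = ((∑ k, g (ω (j, k))) * (√m)⁻¹) • y j := by
      simp only [η, Finset.sum_mul, Finset.sum_smul, smul_smul]
    have h2 : (m : ℝ) * (1 / 2) ≤ ∑ k, g (ω (j, k)) := by
      have := Finset.card_nsmul_le_sum Finset.univ (fun k ↦ g (ω (j, k))) (1 / 2) fun k _ ↦ hj k
      simpa using this
    have h3 : √m / 2 ≤ (∑ k, g (ω (j, k))) * (√m)⁻¹ := by
      refine le_trans (le_of_eq ?_) (mul_le_mul_of_nonneg_right h2 (inv_nonneg.2 (Real.sqrt_nonneg _)))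
      rcases Nat.eq_zero_or_pos m with rfl | hm
      · simp
      · have : 0 < √(m : ℝ) := Real.sqrt_pos.2 (by exact_mod_cast hm)
        field_simp
        rw [Real.sq_sqrt (by positivity)]
    rw [h1, norm_smul]
    calc √m / 4 = √m / 2 * (1 / 2) := by ring
      _ ≤ _ := mul_le_mul (h3.trans (le_abs_self _)) (hy j) (by norm_num) (abs_nonneg _)
  have hint := integral_mono (μ := Q) ((integrable_const (2 ^ N * (√m / 4))).indicator hAm)
    (integrable_finsetSum Finset.univ fun s _ ↦ (hflip s).integrable_comp_of_integrable hfi) hlow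
  rw [integral_finsetSum _ fun s _ ↦ (hflip s).integrable_comp_of_integrable hfi,
    integral_indicator_const _ hAm] at hint
  simp only [Function.comp_apply, integral_comp_of_measurePreserving (hflip _) hfm] at hint
  rw [Finset.sum_const, Finset.card_univ, Fintype.card_finset, Fintype.card_fin, smul_eq_mul,
    nsmul_eq_mul] at hint
  push_cast at hint
  have h2N : (0 : ℝ) < 2 ^ N := by positivity
  refine le_of_mul_le_mul_left (le_trans ?_ hint) h2N
  calc (2 : ℝ) ^ N * (√m / 8) = 1 / 2 * (2 ^ N * (√m / 4)) := by ring
    _ ≤ _ := by gcongr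

end RandomSums

section Dvoretzky

open MeasureTheory

variable {E : Type*} [NormedAddCommGroup E] [NormedSpace ℝ E]

/-- A nearly constant norm on a net of the sphere gives a nearly isometric map. -/
theorem bounds_of_bounds_on_net {H : Type*} [NormedAddCommGroup H] [NormedSpace ℝ H]
    (T : H →L[ℝ] E) {A : Set H} {M : ℝ} (hM : 0 ≤ M)
    (hA : ∀ u : H, ‖u‖ = 1 → ∃ a ∈ A, ‖u - a‖ ≤ 1 / 4)
    (hT : ∀ a ∈ A, 3 / 4 * M ≤ ‖T a‖ ∧ ‖T a‖ ≤ 5 / 4 * M) (u : H) :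
    M / 3 * ‖u‖ ≤ ‖T u‖ ∧ ‖T u‖ ≤ 5 / 3 * M * ‖u‖ := by
  have hup : ‖T‖ ≤ 5 / 3 * M := by
    have h1 : ‖T‖ ≤ 5 / 4 * M + ‖T‖ * (1 / 4) := by
      refine T.opNorm_le_of_unit_norm (by positivity) fun u hu ↦ ?_
      obtain ⟨a, haA, ha⟩ := hA u hu
      calc ‖T u‖ = ‖T a + T (u - a)‖ := by rw [← map_add, add_sub_cancel]
        _ ≤ ‖T a‖ + ‖T (u - a)‖ := norm_add_le _ _
        _ ≤ _ := add_le_add (hT a haA).2 (T.le_opNorm_of_le ha)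
    linarith
  have hle : ∀ u, ‖T u‖ ≤ 5 / 3 * M * ‖u‖ := fun u ↦ T.le_of_opNorm_le hup u
  refine ⟨?_, hle u⟩
  have hunit : ∀ u : H, ‖u‖ = 1 → M / 3 ≤ ‖T u‖ := fun u hu ↦ by
    obtain ⟨a, haA, ha⟩ := hA u hu
    have h1 : ‖T a‖ ≤ ‖T u‖ + ‖T (u - a)‖ := by
      calc ‖T a‖ = ‖T u - T (u - a)‖ := by rw [← map_sub, sub_sub_cancel]
        _ ≤ _ := norm_sub_le _ _
    have h2 : ‖T (u - a)‖ ≤ 5 / 3 * M * (1 / 4) := (hle _).trans (by gcongr)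
    linarith [(hT a haA).1]
  rcases eq_or_ne u 0 with rfl | hu
  · simp
  · have hu0 : 0 < ‖u‖ := norm_pos_iff.2 hu
    have h1 := hunit (‖u‖⁻¹ • u) (by rw [norm_smul]; simp [hu0.ne'])
    rw [map_smul, norm_smul, norm_inv, norm_norm, le_inv_mul_iff₀ hu0] at h1
    linarith

theorem exists_linearIsometryEquiv_apply_eq {H : Type*} [NormedAddCommGroup H]
    [InnerProductSpace ℝ H] {a b : H} (h : ‖a‖ = ‖b‖) : ∃ L : H ≃ₗᵢ[ℝ] H, L a = b := by
  refine ⟨Submodule.reflection (ℝ ∙ (a - b))ᗮ, Submodule.reflection_sub h⟩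

/-- A rotation-invariant bounded random vector. -/
theorem exists_rotationInvariant (n : ℕ) :
    ∃ (μ : Measure (EuclideanSpace ℝ (Fin n)))
      (ξ : EuclideanSpace ℝ (Fin n) → EuclideanSpace ℝ (Fin n)),
      IsProbabilityMeasure μ ∧ Measurable ξ ∧ (∀ ω, ‖ξ ω‖ ≤ 1) ∧
      (∀ L : EuclideanSpace ℝ (Fin n) ≃ₗᵢ[ℝ] EuclideanSpace ℝ (Fin n),
        MeasurePreserving L μ μ ∧ ∀ ω, ξ (L ω) = L (ξ ω)) ∧
      ∀ a, ‖a‖ = 1 → 0 < μ.real {ω | 1 / 2 ≤ inner ℝ (ξ ω) a} := by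
  let B : Set (EuclideanSpace ℝ (Fin n)) := Metric.closedBall 0 1
  have hBm : MeasurableSet B := measurableSet_closedBall
  have hB0 : volume B ≠ 0 := (Metric.measure_closedBall_pos volume _ one_pos).ne'
  have hBt : volume B ≠ ⊤ := measure_closedBall_lt_top.ne
  have hprob : IsProbabilityMeasure (ProbabilityTheory.cond volume B) :=
    ProbabilityTheory.cond_isProbabilityMeasure_of_finite hB0 hBt
  refine ⟨ProbabilityTheory.cond volume B, B.indicator id, hprob, measurable_id.indicator hBm,
    fun ω ↦ ?_, fun L ↦ ⟨?_, fun ω ↦ ?_⟩, fun a ha ↦ ?_⟩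
  · by_cases hω : ω ∈ B
    · rw [Set.indicator_of_mem hω]
      exact mem_closedBall_zero_iff.1 hω
    · simp [hω]
  · have h1 : L ⁻¹' B = B := by ext; simp [B]
    have h2 := L.measurePreserving.restrict_preimage hBm
    rw [h1] at h2
    exact h2.smul_measure _
  · have h1 : L ω ∈ B ↔ ω ∈ B := by simp [B]
    by_cases hω : ω ∈ B
    · simp [hω, h1.2 hω]
    · simp [hω, mt h1.1 hω]
  · have hsub : Metric.ball ((3 / 4 : ℝ) • a) (1 / 4) ⊆
        B ∩ {ω | 1 / 2 ≤ inner ℝ (B.indicator id ω) a} := by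
      intro ω hω
      rw [mem_ball_iff_norm] at hω
      have h1 : ‖(3 / 4 : ℝ) • a‖ = 3 / 4 := by rw [norm_smul, ha]; norm_num
      have hωB : ω ∈ B := by
        have := norm_add_le (ω - (3 / 4 : ℝ) • a) ((3 / 4 : ℝ) • a)
        rw [sub_add_cancel] at this
        rw [mem_closedBall_zero_iff]
        linarith
      refine ⟨hωB, ?_⟩
      rw [Set.mem_ofPred_eq, Set.indicator_of_mem hωB, id]
      have h2 : inner ℝ ω a = inner ℝ (ω - (3 / 4 : ℝ) • a) a + 3 / 4 := by
        rw [inner_sub_left, inner_smul_left, real_inner_self_eq_norm_sq, ha]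
        simp
      have h3 := (abs_le.1 (abs_real_inner_le_norm (ω - (3 / 4 : ℝ) • a) a)).1
      rw [ha, mul_one] at h3
      linarith
    refine ENNReal.toReal_pos (ne_of_gt ?_) (measure_ne_top _ _)
    rw [ProbabilityTheory.cond_apply hBm]
    exact ENNReal.mul_pos (ENNReal.inv_ne_zero.2 hBt)
      ((Metric.measure_ball_pos volume _ (by norm_num)).trans_le (measure_mono hsub)).ne'

theorem norm_sum_blocks_sq_le {N m : ℕ} {y : Fin N → E}
    (hy : ∀ a : Fin N → ℝ, ‖∑ i, a i • y i‖ ^ 2 ≤ ∑ i, a i ^ 2) (a : Fin N × Fin m → ℝ) :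
    ‖∑ p, a p • (√m)⁻¹ • y p.1‖ ^ 2 ≤ ∑ p, a p ^ 2 := by
  have h1 : ∑ p, a p • (√m)⁻¹ • y p.1 = ∑ i, ((∑ k, a (i, k)) * (√m)⁻¹) • y i := by
    simp only [Fintype.sum_prod_type, Finset.sum_mul, Finset.sum_smul, smul_smul]
  rw [h1, Fintype.sum_prod_type]
  refine (hy _).trans (Finset.sum_le_sum fun i _ ↦ ?_)
  have h2 := sq_sum_le_card_mul_sum_sq (s := Finset.univ) (f := fun k ↦ a (i, k))
  rw [Finset.card_univ, Fintype.card_fin] at h2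
  rw [mul_pow, inv_pow, Real.sq_sqrt (by positivity)]
  rcases Nat.eq_zero_or_pos m with rfl | hm
  · simp
  · rw [← div_eq_mul_inv, div_le_iff₀ (by exact_mod_cast hm)]
    linarith

/-- Dvoretzky's theorem, with a fixed distortion. -/
theorem exists_euclidean_subspace (hE : ¬ FiniteDimensional ℝ E) (n : ℕ) :
    ∃ T : EuclideanSpace ℝ (Fin n) →ₗ[ℝ] E, ∀ a, ‖a‖ ≤ ‖T a‖ ∧ ‖T a‖ ≤ 5 * ‖a‖ := by
  rcases Nat.eq_zero_or_pos n with rfl | hn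
  · exact ⟨0, fun a ↦ by simp [Subsingleton.elim a 0]⟩
  obtain ⟨μ, ξ, hμ, hξm, hξ1, hinv, hpos⟩ := exists_rotationInvariant n
  obtain ⟨A, hAs, hAfin, hAcov⟩ := (isCompact_sphere (0 : EuclideanSpace ℝ (Fin n)) 1).finite_cover_balls
    (e := 1 / 4) (by norm_num)
  have hA1 : ∀ a ∈ A, ‖a‖ = 1 := fun a ha ↦ by simpa using hAs ha
  have hnet : ∀ u : EuclideanSpace ℝ (Fin n), ‖u‖ = 1 → ∃ a ∈ A, ‖u - a‖ ≤ 1 / 4 := fun u hu ↦ by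
    obtain ⟨a, ha, hua⟩ := Set.mem_iUnion₂.1 (hAcov (by simpa using hu : u ∈ Metric.sphere 0 1))
    exact ⟨a, ha, (mem_ball_iff_norm.1 hua).le⟩
  lift A to Finset (EuclideanSpace ℝ (Fin n)) using hAfin
  let a₀ : EuclideanSpace ℝ (Fin n) := EuclideanSpace.single ⟨0, hn⟩ 1
  have ha₀ : ‖a₀‖ = 1 := by simp [a₀]
  let g : EuclideanSpace ℝ (Fin n) → EuclideanSpace ℝ (Fin n) → ℝ := fun a ω ↦ inner ℝ (ξ ω) a
  have hgm : ∀ a, Measurable (g a) := fun a ↦ hξm.inner_const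
  have hg1 : ∀ a, ‖a‖ = 1 → ∀ ω, |g a ω| ≤ 1 := fun a ha ω ↦ by
    have := abs_real_inner_le_norm (ξ ω) a
    rw [ha, mul_one] at this
    exact this.trans (hξ1 ω)
  set p := μ.real {ω | 1 / 2 ≤ g a₀ ω} with hp
  have hp0 : 0 < p := hpos a₀ ha₀
  obtain ⟨m, hm⟩ := exists_nat_gt (4096 * A.card : ℝ)
  have hm0 : (0 : ℝ) < m := lt_of_le_of_lt (by positivity) hm
  obtain ⟨N, hN⟩ := exists_pow_lt_of_lt_one (by norm_num : (0 : ℝ) < 1 / 2)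
    (by linarith [pow_pos hp0 m] : 1 - p ^ m < 1)
  obtain ⟨y, hy, hysq⟩ := exists_dvoretzky_rogers hE N
  set Q := Measure.pi fun _ : Fin N × Fin m ↦ μ with hQ
  let f : EuclideanSpace ℝ (Fin n) → (Fin N × Fin m → EuclideanSpace ℝ (Fin n)) → ℝ :=
    fun a ω ↦ ‖∑ p, g a (ω p) • (√m)⁻¹ • y p.1‖
  have hfm : ∀ a, Measurable (f a) := fun a ↦
    measurable_norm_sum_smul (hgm a) fun p : Fin N × Fin m ↦ (√m)⁻¹ • y p.1
  set M := ∫ ω, f a₀ ω ∂Q with hM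
  have hfM : ∀ a, ‖a‖ = 1 → ∫ ω, f a ω ∂Q = M := fun a ha ↦ by
    obtain ⟨L, hL⟩ := exists_linearIsometryEquiv_apply_eq (ha₀.trans ha.symm)
    have hLQ : MeasurePreserving (fun ω p ↦ L (ω p)) Q Q :=
      measurePreserving_pi (fun _ : Fin N × Fin m ↦ μ) (fun _ : Fin N × Fin m ↦ μ)
        (f := fun _ ω ↦ L ω) fun _ ↦ (hinv L).1
    rw [← integral_comp_of_measurePreserving hLQ (hfm a), hM]
    congr 1
    ext ω
    simp only [f, g, (hinv L).2, ← hL, L.inner_map_map]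
  have hMlow : √m / 8 ≤ M := by
    obtain ⟨L, hL⟩ := exists_linearIsometryEquiv_apply_eq (norm_neg a₀).symm
    refine le_integral_norm_sum μ (hgm a₀) (hg1 a₀ ha₀) (hinv L).1 (fun ω ↦ ?_) hy hN.le
    have hL' : a₀ = L (-a₀) := by rw [map_neg, hL, neg_neg]
    calc g a₀ (L ω) = inner ℝ (L (ξ ω)) (L (-a₀)) := by rw [← hL', ← (hinv L).2]
      _ = -g a₀ ω := by rw [L.inner_map_map, inner_neg_right]
  have hM0 : 0 < M := lt_of_lt_of_le (by positivity) hMlow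
  have hvar : ∀ a ∈ A, ∫ ω, (f a ω - M) ^ 2 ∂Q ≤ 4 := fun a ha ↦ by
    rw [← hfM a (hA1 a ha)]
    exact variance_norm_sum_le μ (hgm a) (hg1 a (hA1 a ha)) (norm_sum_blocks_sq_le hysq)
  have hint : ∀ a ∈ A, Integrable (fun ω ↦ (f a ω - M) ^ 2) Q := fun a ha ↦ by
    refine Integrable.of_bound (((hfm a).sub_const M).pow_const 2).aestronglyMeasurable
      ((∑ p : Fin N × Fin m, ‖(√m)⁻¹ • y p.1‖ + M) ^ 2) (Eventually.of_forall fun ω ↦ ?_)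
    rw [norm_pow]
    refine pow_le_pow_left₀ (norm_nonneg _) ?_ 2
    refine (norm_sub_le _ _).trans ?_
    rw [Real.norm_of_nonneg hM0.le, Real.norm_of_nonneg (norm_nonneg _)]
    gcongr
    exact norm_sum_smul_le (hg1 a (hA1 a ha)) (fun p : Fin N × Fin m ↦ (√m)⁻¹ • y p.1) ω
  obtain ⟨ω, hω⟩ := exists_le_integral (integrable_finsetSum A hint)
  rw [integral_finsetSum A hint] at hω
  have hω' : ∑ a ∈ A, (f a ω - M) ^ 2 ≤ A.card * 4 := by
    refine hω.trans ((Finset.sum_le_card_nsmul A _ 4 hvar).trans_eq ?_)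
    rw [nsmul_eq_mul]
  have hfω : ∀ a ∈ A, |f a ω - M| ≤ M / 4 := fun a ha ↦ by
    refine abs_le_of_sq_le_sq ?_ (by positivity)
    have h1 := Finset.single_le_sum (f := fun a ↦ (f a ω - M) ^ 2) (fun a _ ↦ sq_nonneg _) ha
    have h2 : (√m / 8) ^ 2 ≤ M ^ 2 := by gcongr
    rw [div_pow, Real.sq_sqrt hm0.le] at h2
    linarith
  let T : EuclideanSpace ℝ (Fin n) →ₗ[ℝ] E :=
    ∑ p, (innerₗ _ (ξ (ω p))).smulRight ((√m)⁻¹ • y p.1)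
  have hT : ∀ a, ‖T a‖ = f a ω := fun a ↦ by simp [T, f, g, LinearMap.sum_apply]
  have key := bounds_of_bounds_on_net T.toContinuousLinearMap hM0.le hnet fun a ha ↦ by
    have := abs_le.1 (hfω a ha)
    rw [LinearMap.coe_toContinuousLinearMap', hT]
    constructor <;> linarith
  refine ⟨(3 / M) • T, fun a ↦ ?_⟩
  obtain ⟨h1, h2⟩ := key a
  rw [LinearMap.coe_toContinuousLinearMap'] at h1 h2
  rw [LinearMap.smul_apply, norm_smul, Real.norm_of_nonneg (by positivity)]
  constructor
  · calc ‖a‖ = 3 / M * (M / 3 * ‖a‖) := by field_simp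
      _ ≤ _ := by gcongr
  · calc 3 / M * ‖T a‖ ≤ 3 / M * (5 / 3 * M * ‖a‖) := by gcongr
      _ = 5 * ‖a‖ := by field_simp

end Dvoretzky

section LindenstraussTzafriri

variable {E : Type*} [NormedAddCommGroup E] [NormedSpace ℝ E]

theorem EuclideanDistortionLE.mono {F : Submodule ℝ E} {d d' : ℝ}
    (h : EuclideanDistortionLE F d) (hd : d ≤ d') : EuclideanDistortionLE F d' := by
  obtain ⟨k, v, hv⟩ := h
  exact ⟨k, v, fun x ↦ ⟨(hv x).1, (hv x).2.trans (by gcongr)⟩⟩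

theorem EuclideanDistortionLE.of_innerProductSpace {F : Submodule ℝ E} {d : ℝ}
    {H : Type*} [NormedAddCommGroup H] [InnerProductSpace ℝ H] [FiniteDimensional ℝ H]
    (v : F →ₗ[ℝ] H) (hv : ∀ x, ‖x‖ ≤ ‖v x‖ ∧ ‖v x‖ ≤ d * ‖x‖) : EuclideanDistortionLE F d :=
  ⟨_, (stdOrthonormalBasis ℝ H).repr.toLinearMap ∘ₗ v, fun x ↦ by simpa using hv x⟩

theorem exists_euclideanDistortionLE (F : Submodule ℝ E) [FiniteDimensional ℝ F] :
    ∃ d, 1 ≤ d ∧ EuclideanDistortionLE F d := by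
  let e : F ≃L[ℝ] EuclideanSpace ℝ (Fin (Module.finrank ℝ F)) := toEuclidean
  let a : ℝ := ‖(e.symm : EuclideanSpace ℝ (Fin (Module.finrank ℝ F)) →L[ℝ] F)‖
  let b : ℝ := ‖(e : F →L[ℝ] EuclideanSpace ℝ (Fin (Module.finrank ℝ F)))‖
  have hab : EuclideanDistortionLE F (a * b) := by
    refine ⟨_, a • (e : F →ₗ[ℝ] EuclideanSpace ℝ (Fin (Module.finrank ℝ F))), fun x ↦ ?_⟩
    have ha : 0 ≤ a := ContinuousLinearMap.opNorm_nonneg _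
    have h1 : ‖x‖ ≤ a * ‖e x‖ := by
      simpa using (e.symm : EuclideanSpace ℝ (Fin (Module.finrank ℝ F)) →L[ℝ] F).le_opNorm (e x)
    have h2 : ‖e x‖ ≤ b * ‖x‖ :=
      (e : F →L[ℝ] EuclideanSpace ℝ (Fin (Module.finrank ℝ F))).le_opNorm x
    have h3 : ‖(a • (e : F →ₗ[ℝ] EuclideanSpace ℝ (Fin (Module.finrank ℝ F)))) x‖
        = a * ‖e x‖ := by
      rw [LinearMap.smul_apply, norm_smul, Real.norm_of_nonneg ha]
      rfl
    rw [h3]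
    exact ⟨h1, by rw [mul_assoc]; gcongr⟩
  exact ⟨max 1 (a * b), le_max_left _ _, hab.mono (le_max_right _ _)⟩

/-- Every finite-dimensional subspace of `E` is the range of a projection of norm at most `l`. -/
def FiniteDimensionalComplementedBy (E : Type*) [NormedAddCommGroup E] [NormedSpace ℝ E]
    (l : ℝ) : Prop :=
  ∀ (M : Submodule ℝ E) [FiniteDimensional ℝ M],
    ∃ P : E →ₗ[ℝ] M, (∀ x, ‖P x‖ ≤ l * ‖x‖) ∧ ∀ m : M, P m = m

/-- Projecting onto the graph of a map from `F` to a nearly Euclidean subspace improves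
the Euclidean distortion of `F` to the order of its square root. -/
theorem EuclideanDistortionLE.improve (hE : ¬ FiniteDimensional ℝ E) {l : ℝ} (hl : 1 ≤ l)
    (hP : FiniteDimensionalComplementedBy E l) {F : Submodule ℝ E} [FiniteDimensional ℝ F]
    {d : ℝ} (hd : 1 ≤ d) (h : EuclideanDistortionLE F d) :
    EuclideanDistortionLE F ((2 * (1 + l) * l + 10 * l ^ 2) * √d) := by
  obtain ⟨k, v, hv⟩ := h
  obtain ⟨Q, hQ, hQF⟩ := hP F
  have hker : ¬ FiniteDimensional ℝ (LinearMap.ker Q) := by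
    intro hfin
    refine hE ?_
    have : FiniteDimensional ℝ (LinearMap.range Q) := inferInstance
    have : FiniteDimensional ℝ (E ⧸ LinearMap.ker Q) :=
      Module.Finite.equiv Q.quotKerEquivRange.symm
    exact Module.Finite.of_submodule_quotient (LinearMap.ker Q)
  obtain ⟨T₀, hT₀⟩ := exists_euclidean_subspace hker k
  let T : EuclideanSpace ℝ (Fin k) →ₗ[ℝ] E := (LinearMap.ker Q).subtype ∘ₗ T₀
  have hQT : ∀ a, Q (T a) = 0 := fun a ↦ (T₀ a).2
  have hT : ∀ a, ‖a‖ ≤ ‖T a‖ ∧ ‖T a‖ ≤ 5 * ‖a‖ := hT₀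
  have hd0 : 0 < √d := Real.sqrt_pos.2 (by linarith)
  have hdd : √d * √d = d := Real.mul_self_sqrt (by linarith)
  let t : ℝ := (√d)⁻¹
  have ht : 0 < t := inv_pos.2 hd0
  have htd : t * d = √d := by
    calc t * d = t * (√d * √d) := by rw [hdd]
      _ = √d := by simp only [t]; field_simp
  let g : F →ₗ[ℝ] E := F.subtype + t • T ∘ₗ v
  have hg : ∀ x : F, g x = x + t • T (v x) := fun x ↦ rfl
  have hQg : ∀ x : F, Q (g x) = x := fun x ↦ by simp [hg, hQF, hQT]
  obtain ⟨P, hPl, hPG⟩ := hP (LinearMap.range g)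
  have hgQ : ∀ z : LinearMap.range g, g (Q z) = z := by
    rintro ⟨_, x, rfl⟩
    simp [hQg]
  -- the components of the graph projection
  let A : E →ₗ[ℝ] F := Q ∘ₗ (LinearMap.range g).subtype ∘ₗ P
  have hA : ∀ x, ‖A x‖ ≤ l * (l * ‖x‖) := fun x ↦ (hQ _).trans (by gcongr; exact hPl x)
  have hdecomp : ∀ x : F, A x + t • A (T (v x)) = x := by
    intro x
    rw [← map_smul, ← map_add, ← hg]
    have := hPG ⟨g x, LinearMap.mem_range_self g x⟩
    simp only at this
    simp [A, this, hQg]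
  have hvA : ∀ x : E, ‖v (A x)‖ ≤ √d * ((1 + l) * (l * ‖x‖)) := by
    intro x
    have h1 : (P x : E) = A x + t • T (v (A x)) := by rw [← hg]; exact (hgQ (P x)).symm
    have h2 : t * ‖v (A x)‖ ≤ (1 + l) * (l * ‖x‖) := by
      calc t * ‖v (A x)‖ ≤ t * ‖T (v (A x))‖ := by gcongr; exact (hT _).1
        _ = ‖(P x : E) - A x‖ := by
          rw [h1, add_sub_cancel_left, norm_smul, Real.norm_of_nonneg ht.le]
        _ ≤ ‖(P x : E)‖ + ‖(A x : E)‖ := norm_sub_le _ _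
        _ ≤ ‖P x‖ + l * ‖P x‖ := by gcongr; exacts [le_rfl, hQ _]
        _ = (1 + l) * ‖P x‖ := by ring
        _ ≤ _ := by gcongr; exact hPl x
    calc ‖v (A x)‖ = √d * (t * ‖v (A x)‖) := by simp only [t]; field_simp
      _ ≤ _ := by gcongr
  let w : F →ₗ[ℝ] WithLp 2 (EuclideanSpace ℝ (Fin k) × EuclideanSpace ℝ (Fin k)) :=
    (WithLp.linearEquiv 2 ℝ _).symm.toLinearMap ∘ₗ
      ((2 : ℝ) • v ∘ₗ A ∘ₗ F.subtype).prod ((10 * l ^ 2 * t) • v)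
  have hw : ∀ x, ‖w x‖ ^ 2 = (2 * ‖v (A x)‖) ^ 2 + (10 * l ^ 2 * t * ‖v x‖) ^ 2 := by
    intro x
    rw [WithLp.prod_norm_sq_eq_of_L2]
    simp [w, norm_smul, mul_pow, abs_of_pos ht]
  refine .of_innerProductSpace w fun x ↦ ⟨?_, ?_⟩
  · have h1 : ‖x‖ ≤ ‖v (A x)‖ + 5 * l ^ 2 * t * ‖v x‖ := by
      calc ‖x‖ = ‖A x + t • A (T (v x))‖ := by rw [hdecomp]
        _ ≤ ‖A x‖ + t * ‖A (T (v x))‖ := by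
          refine (norm_add_le _ _).trans_eq ?_
          rw [norm_smul, Real.norm_of_nonneg ht.le]
        _ ≤ ‖v (A x)‖ + t * (l * (l * (5 * ‖v x‖))) := by
          gcongr
          · exact (hv _).1
          · refine (hA _).trans ?_
            gcongr
            exact (hT _).2
        _ = _ := by ring
    refine abs_le_of_sq_le_sq' ?_ (norm_nonneg _) |>.2
    rw [hw]
    have h2 := pow_le_pow_left₀ (norm_nonneg x) h1 2
    nlinarith [sq_nonneg (‖v (A x)‖ - 5 * l ^ 2 * t * ‖v x‖), sq_nonneg ‖v (A x)‖,
      sq_nonneg (5 * l ^ 2 * t * ‖v x‖)]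
  · have h1 : 2 * ‖v (A x)‖ ≤ 2 * (1 + l) * l * √d * ‖x‖ := by
      have h0 : ‖(x : E)‖ = ‖x‖ := rfl
      have := hvA x
      rw [h0] at this
      nlinarith
    have h2 : 10 * l ^ 2 * t * ‖v x‖ ≤ 10 * l ^ 2 * √d * ‖x‖ := by
      calc 10 * l ^ 2 * t * ‖v x‖ ≤ 10 * l ^ 2 * t * (d * ‖x‖) := by
            gcongr; exact (hv x).2
        _ = 10 * l ^ 2 * √d * ‖x‖ := by
          rw [← htd]; ring
    have h3 : 0 ≤ 2 * ‖v (A x)‖ := by positivity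
    have h4 : 0 ≤ 10 * l ^ 2 * t * ‖v x‖ := by positivity
    have h5 : (2 * (1 + l) * l + 10 * l ^ 2) * √d * ‖x‖
      = 2 * (1 + l) * l * √d * ‖x‖ + 10 * l ^ 2 * √d * ‖x‖ := by ring
    refine abs_le_of_sq_le_sq' ?_ (by positivity) |>.2
    rw [hw, h5]
    nlinarith [mul_nonneg h3 h4]

/-- The Lindenstrauss–Tzafriri theorem, in its finite-dimensional form. -/
theorem euclideanDistortionLE_of_complementedBy (hE : ¬ FiniteDimensional ℝ E) {l : ℝ}
    (hl : 1 ≤ l) (hP : FiniteDimensionalComplementedBy E l) (F : Submodule ℝ E)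
    [FiniteDimensional ℝ F] :
    EuclideanDistortionLE F ((2 * (1 + l) * l + 10 * l ^ 2) ^ 2 + 1) := by
  set C : ℝ := 2 * (1 + l) * l + 10 * l ^ 2 with hC
  have hC1 : 1 ≤ C := by nlinarith
  let S : Set ℝ := {d | 1 ≤ d ∧ EuclideanDistortionLE F d}
  have hne : S.Nonempty := exists_euclideanDistortionLE F
  have hbdd : BddBelow S := ⟨1, fun d hd ↦ hd.1⟩
  have hD1 : 1 ≤ sInf S := le_csInf hne fun d hd ↦ hd.1
  have hstep : ∀ d ∈ S, (sInf S / C) ^ 2 ≤ d := by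
    rintro d ⟨hd1, hd⟩
    have h1 : 1 ≤ √d := Real.one_le_sqrt.2 hd1
    have h2 : sInf S ≤ C * √d := csInf_le hbdd ⟨by nlinarith, hd.improve hE hl hP hd1⟩
    have h3 : sInf S / C ≤ √d := by rw [div_le_iff₀' (by linarith)]; exact h2
    calc (sInf S / C) ^ 2 ≤ √d ^ 2 := by gcongr
      _ = d := Real.sq_sqrt (by linarith)
  have hD : sInf S ≤ C ^ 2 := by
    have h1 := le_csInf hne hstep
    rw [div_pow, div_le_iff₀ (by positivity)] at h1
    nlinarith
  obtain ⟨d, hd, hlt⟩ := exists_lt_of_csInf_lt hne (by linarith : sInf S < C ^ 2 + 1)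
  exact hd.2.mono hlt.le

theorem exists_uniform_euclideanDistortionLE [FiniteDimensional ℝ E] :
    ∃ d, ∀ F : Submodule ℝ E, EuclideanDistortionLE F d := by
  obtain ⟨d, -, k, v, hv⟩ := exists_euclideanDistortionLE (⊤ : Submodule ℝ E)
  exact ⟨d, fun F ↦ ⟨k, v ∘ₗ Submodule.inclusion le_top, fun x ↦ hv (Submodule.inclusion le_top x)⟩⟩

end LindenstraussTzafriri

end Auxiliary

/-- Theorem 3.B.8: if there is a `c > 0` such that for every finite-dimensional subspace
`M` of the real Banach space `X` the quotient map `X → X/M` admits a `c`-Lipschitz right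
inverse, then `X` is isomorphic to a Hilbert space. -/
theorem uniform_lipschitz_right_inverse_on_finite_dim_implies_hilbert [CompleteSpace X]
    (c : ℝ≥0) (hc : 0 < c)
    (h : ∀ (M : Submodule ℝ X) [FiniteDimensional ℝ M] [IsClosed (M : Set X)],
      ∃ ψ : X ⧸ M → X, LipschitzWith c ψ ∧
        ∀ u : X ⧸ M, Submodule.Quotient.mk (ψ u) = u) :
    IsomorphicToHilbert X := by
  by_cases hX : FiniteDimensional ℝ X
  · obtain ⟨d, hd⟩ := exists_uniform_euclideanDistortionLE (E := X)
    exact isomorphicToHilbert_of_finiteDimensional fun F _ ↦ hd F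
  · have hP : FiniteDimensionalComplementedBy X (1 + c) := fun M _ ↦ by
      have : IsClosed (M : Set X) := M.closed_of_finiteDimensional
      obtain ⟨ψ, hψ, hψM⟩ := h M
      exact exists_projection_of_lipschitz_right_inverse M ψ hψ hψM
    exact isomorphicToHilbert_of_finiteDimensional fun F _ ↦
      euclideanDistortionLE_of_complementedBy hX (by simp) hP F
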